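/- Every monomial m = c·x^α ∈ ℝ[x₁,…,xₙ] with c ≠ 0 admits a DCSOS decomposition m = g − h where g and h are CSOS polynomials of total degree at most 2⌈|α|/2⌉, where |α| = α₁ + ⋯ + αₙ is the degree of the monomial. -/

import Mathlib

open MvPolynomial

/-- A polynomial is SOS if it is a finite sum of squares of polynomials. -/
def IsSOS {n : ℕ} (p : MvPolynomial (Fin n) ℝ) : Prop :=
  ∃ (m : ℕ) (q : Fin m → MvPolynomial (Fin n) ℝ), p = ∑ i, (q i) ^ 2

/-- A polynomial is CSOS if it is SOS and its evaluation function on ℝⁿ is convex. -/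
def IsCSOS {n : ℕ} (p : MvPolynomial (Fin n) ℝ) : Prop :=
  IsSOS p ∧ ConvexOn ℝ Set.univ (fun x : Fin n → ℝ => eval x p)

section

/-- **Polarization identity**: a product of `d` elements is an alternating sum of `d`-th powers. -/
theorem sum_neg_one_pow_card_mul_sum_compl_pow {R : Type*} [CommRing R] {d : ℕ} (l : Fin d → R) :
    ∑ s : Finset (Fin d), (-1) ^ s.card * (∑ i ∈ sᶜ, l i) ^ d = (d.factorial : R) * ∏ i, l i := by
  classical
  have avoid (f : Fin d → Fin d) :
      ∑ s : Finset (Fin d), (if ∀ j, f j ∈ sᶜ then (-1 : R) ^ s.card else 0) =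
        if Function.Bijective f then 1 else 0 := by
    have hs : Finset.univ.filter (fun s : Finset (Fin d) => ∀ j, f j ∈ sᶜ) =
        (Finset.univ.image f)ᶜ.powerset := by
      ext s
      simp only [Finset.mem_filter, Finset.mem_univ, true_and, Finset.mem_powerset,
        Finset.subset_compl_comm (s := s), Finset.subset_iff, Finset.mem_image,
        forall_exists_index, forall_apply_eq_imp_iff]
    rw [← Finset.sum_filter, hs]
    have h := congrArg (Int.cast : ℤ → R)
      (Finset.sum_powerset_neg_one_pow_card (x := (Finset.univ.image f)ᶜ))
    push_cast at h
    rw [h]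
    simp only [Finset.compl_eq_empty_iff, Finset.eq_univ_iff_forall, Finset.mem_image,
      Finset.mem_univ, true_and, ← Finite.surjective_iff_bijective, Function.Surjective]
  have expand (s : Finset (Fin d)) : (∑ i ∈ sᶜ, l i) ^ d =
      ∑ f : Fin d → Fin d, if ∀ j, f j ∈ sᶜ then ∏ j, l (f j) else 0 := by
    rw [Finset.sum_pow', ← Finset.sum_filter]
    refine Finset.sum_congr ?_ fun _ _ => rfl
    ext f
    simp
  calc ∑ s : Finset (Fin d), (-1) ^ s.card * (∑ i ∈ sᶜ, l i) ^ d
      = ∑ f : Fin d → Fin d, (∑ s : Finset (Fin d),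
          if ∀ j, f j ∈ sᶜ then (-1 : R) ^ s.card else 0) * ∏ j, l (f j) := by
        simp_rw [expand, Finset.mul_sum, Finset.sum_mul]
        rw [Finset.sum_comm]
        refine Finset.sum_congr rfl fun f _ => Finset.sum_congr rfl fun s _ => ?_
        split_ifs <;> simp
    _ = ∑ f : Fin d → Fin d with Function.Bijective f, ∏ j, l j := by
        simp_rw [avoid, ite_mul, one_mul, zero_mul, ← Finset.sum_filter]
        exact Finset.sum_congr rfl fun f hf =>
          (Finset.mem_filter.1 hf).2.prod_comp l
    _ = (d.factorial : R) * ∏ i, l i := by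
        have hcard : (Finset.univ.filter fun f : Fin d → Fin d => Function.Bijective f).card =
            d.factorial := by
          rw [← Fintype.card_subtype,
            ← Fintype.card_congr (Equiv.ofBijective
              (fun e : Equiv.Perm (Fin d) => (⟨e, e.bijective⟩ :
                {f : Fin d → Fin d // Function.Bijective f}))
              ⟨fun e e' h => Equiv.coe_fn_injective (congrArg Subtype.val h),
                fun f => ⟨Equiv.ofBijective f.1 f.2, rfl⟩⟩),
            Fintype.card_perm, Fintype.card_fin]
        rw [Finset.sum_const, hcard, nsmul_eq_mul]

variable {n : ℕ}

theorem IsSOS.add {p q : MvPolynomial (Fin n) ℝ} (hp : IsSOS p) (hq : IsSOS q) :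
    IsSOS (p + q) := by
  obtain ⟨k, f, rfl⟩ := hp
  obtain ⟨m, g, rfl⟩ := hq
  exact ⟨k + m, Fin.append f g, by simp [Fin.sum_univ_add]⟩

theorem IsSOS.smul {p : MvPolynomial (Fin n) ℝ} (hp : IsSOS p) {a : ℝ} (ha : 0 ≤ a) :
    IsSOS (a • p) := by
  obtain ⟨k, f, rfl⟩ := hp
  exact ⟨k, fun i => √a • f i, by simp [smul_pow, Real.sq_sqrt ha, Finset.smul_sum]⟩

theorem IsCSOS.zero : IsCSOS (0 : MvPolynomial (Fin n) ℝ) :=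
  ⟨⟨0, Fin.elim0, by simp⟩, by simpa using convexOn_const (0 : ℝ) convex_univ⟩

theorem IsCSOS.add {p q : MvPolynomial (Fin n) ℝ} (hp : IsCSOS p) (hq : IsCSOS q) :
    IsCSOS (p + q) :=
  ⟨hp.1.add hq.1, by simp only [map_add]; exact hp.2.add hq.2⟩

theorem IsCSOS.smul {p : MvPolynomial (Fin n) ℝ} (hp : IsCSOS p) {a : ℝ} (ha : 0 ≤ a) :
    IsCSOS (a • p) :=
  ⟨hp.1.smul ha, by simpa only [smul_eval, smul_eq_mul] using hp.2.smul ha⟩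

/-- The polynomials with a DCSOS decomposition into components of total degree at most `D`. -/
def dcsosSubmodule (n D : ℕ) : Submodule ℝ (MvPolynomial (Fin n) ℝ) where
  carrier := {p | ∃ g h : MvPolynomial (Fin n) ℝ, IsCSOS g ∧ IsCSOS h ∧
    g.totalDegree ≤ D ∧ h.totalDegree ≤ D ∧ p = g - h}
  zero_mem' := ⟨0, 0, .zero, .zero, by simp, by simp, by simp⟩
  add_mem' := by
    rintro _ _ ⟨g, h, hg, hh, hgD, hhD, rfl⟩ ⟨g', h', hg', hh', hgD', hhD', rfl⟩
    exact ⟨g + g', h + h', hg.add hg', hh.add hh', (totalDegree_add _ _).trans (max_le hgD hgD'),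
      (totalDegree_add _ _).trans (max_le hhD hhD'), by ring⟩
  smul_mem' := by
    rintro a _ ⟨g, h, hg, hh, hgD, hhD, rfl⟩
    rcases le_total 0 a with ha | ha
    · exact ⟨a • g, a • h, hg.smul ha, hh.smul ha, (totalDegree_smul_le _ _).trans hgD,
        (totalDegree_smul_le _ _).trans hhD, smul_sub _ _ _⟩
    · have ha' := neg_nonneg.2 ha
      exact ⟨(-a) • h, (-a) • g, hh.smul ha', hg.smul ha', (totalDegree_smul_le _ _).trans hhD,
        (totalDegree_smul_le _ _).trans hgD, by module⟩

/-- The polynomials of the form `a₀ + a₁ x₁ + ⋯ + aₙ xₙ`. -/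
noncomputable def affineForms (n : ℕ) : Submodule ℝ (MvPolynomial (Fin n) ℝ) :=
  Submodule.span ℝ (insert 1 (Set.range X))

theorem totalDegree_le_one_of_mem_affineForms {p : MvPolynomial (Fin n) ℝ}
    (hp : p ∈ affineForms n) : p.totalDegree ≤ 1 := by
  have : affineForms n ≤ restrictTotalDegree (Fin n) ℝ 1 := by
    refine Submodule.span_le.2 ?_
    rintro _ (rfl | ⟨i, rfl⟩) <;> simp [mem_restrictTotalDegree]
  exact (mem_restrictTotalDegree _ _ _).1 (this hp)

theorem eval_combo_of_mem_affineForms {p : MvPolynomial (Fin n) ℝ} (hp : p ∈ affineForms n)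
    (x y : Fin n → ℝ) {a b : ℝ} (hab : a + b = 1) :
    eval (a • x + b • y) p = a * eval x p + b * eval y p := by
  induction hp using Submodule.span_induction with
  | mem q hq => rcases hq with rfl | ⟨i, rfl⟩ <;> simp [hab]
  | zero => simp
  | add q r _ _ hq hr => simp only [map_add, hq, hr]; ring
  | smul t q _ hq => simp only [smul_eval, hq]; ring

theorem isCSOS_pow_of_mem_affineForms {p : MvPolynomial (Fin n) ℝ} (hp : p ∈ affineForms n)
    {D : ℕ} (hD : Even D) : IsCSOS (p ^ D) := by
  refine ⟨?_, convex_univ, fun x _ y _ a b ha hb hab => ?_⟩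
  · obtain ⟨k, rfl⟩ := hD
    exact ⟨1, fun _ => p ^ k, by simp [← pow_mul, mul_two]⟩
  · simp only [map_pow, eval_combo_of_mem_affineForms hp x y hab]
    exact hD.convexOn_pow.2 trivial trivial ha hb hab

theorem pow_mem_dcsosSubmodule {p : MvPolynomial (Fin n) ℝ} (hp : p ∈ affineForms n)
    {D : ℕ} (hD : Even D) : p ^ D ∈ dcsosSubmodule n D := by
  refine ⟨p ^ D, 0, isCSOS_pow_of_mem_affineForms hp hD, .zero, ?_, by simp, by simp⟩
  calc (p ^ D).totalDegree ≤ D * p.totalDegree := totalDegree_pow _ _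
    _ ≤ D * 1 := Nat.mul_le_mul_left _ (totalDegree_le_one_of_mem_affineForms hp)
    _ = D := mul_one D

theorem prod_mem_dcsosSubmodule {D : ℕ} (hD : Even D) (l : Fin D → MvPolynomial (Fin n) ℝ)
    (hl : ∀ i, l i ∈ affineForms n) : ∏ i, l i ∈ dcsosSubmodule n D := by
  have hsum : (D.factorial : ℝ) • ∏ i, l i ∈ dcsosSubmodule n D := by
    have h := sum_neg_one_pow_card_mul_sum_compl_pow l
    rw [Nat.cast_smul_eq_nsmul, nsmul_eq_mul, ← h]
    refine Submodule.sum_mem _ fun s _ => ?_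
    have hs := pow_mem_dcsosSubmodule (Submodule.sum_mem _ fun i (_ : i ∈ sᶜ) => hl i) hD
    rcases neg_one_pow_eq_or (MvPolynomial (Fin n) ℝ) s.card with h | h <;> rw [h]
    · simpa using hs
    · simpa using hs
  exact (Submodule.smul_mem_iff _ (Nat.cast_ne_zero.2 D.factorial_ne_zero)).1 hsum

theorem list_prod_mem_dcsosSubmodule (L : List (MvPolynomial (Fin n) ℝ)) (hL : Even L.length)
    (h : ∀ p ∈ L, p ∈ affineForms n) : L.prod ∈ dcsosSubmodule n L.length := by
  have := prod_mem_dcsosSubmodule hL L.get fun i => h _ (L.get_mem i)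
  rwa [← List.prod_ofFn, List.ofFn_get] at this

end

theorem monomial_dcsos_min_degree {n : ℕ} (α : Fin n →₀ ℕ) (c : ℝ) (hc : c ≠ 0) :
    ∃ g h : MvPolynomial (Fin n) ℝ, IsCSOS g ∧ IsCSOS h ∧
      g.totalDegree ≤ 2 * (((α.sum fun _ e => e) + 1) / 2) ∧
      h.totalDegree ≤ 2 * (((α.sum fun _ e => e) + 1) / 2) ∧
      (monomial α c : MvPolynomial (Fin n) ℝ) = g - h := by
  change monomial α c ∈ dcsosSubmodule n (2 * (((α.sum fun _ e => e) + 1) / 2))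
  set d := α.sum fun _ e => e
  set L : List (MvPolynomial (Fin n) ℝ) :=
    α.toMultiset.toList.map X ++ List.replicate (2 * ((d + 1) / 2) - d) 1 with hLdef
  have hlen : L.length = 2 * ((d + 1) / 2) := by
    have : α.toMultiset.card = d := Finsupp.card_toMultiset α
    simp only [hLdef, List.length_append, List.length_map, Multiset.length_toList,
      List.length_replicate, this]
    lia
  have hprod : L.prod = monomial α 1 := by
    rw [hLdef, List.prod_append, List.prod_replicate, one_pow, mul_one, ← Multiset.prod_coe,
      ← Multiset.map_coe, Multiset.coe_toList, Finsupp.toMultiset_map]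
    simp [monomial_eq, Finsupp.prod_toMultiset, Finsupp.prod_mapDomain_index, pow_add]
  have hmem := list_prod_mem_dcsosSubmodule L (hlen ▸ even_two_mul _) fun p hp => by
    refine Submodule.subset_span ?_
    rcases List.mem_append.1 hp with hp | hp
    · obtain ⟨i, -, rfl⟩ := List.mem_map.1 hp
      exact Or.inr ⟨i, rfl⟩
    · exact Or.inl (List.eq_of_mem_replicate hp)
  rw [hprod, hlen] at hmem
  simpa [smul_monomial] using Submodule.smul_mem _ c hmem
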